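/- From the position P7, placing a chap at i10 is Betty's unique non-losing move: after Betty places a chap at i10, Alfred has no winning strategy from the resulting position, while after every other legal move of Betty from P7, Alfred has a winning strategy from the resulting position. -/

import Mathlib

/-!
Formalization of Philosophers' Phutball on an `m × n` board (`m` rows, `n` columns).
Points are pairs `(column, row)` of integers, with columns `1, …, n` (a, b, c, …)
and rows `1, …, m` (bottom to top).  Player `true` is Alfred (first player, aims
for the top row `m`); player `false` is Betty (aims for the bottom row `1`).
-/

/-- A player: `true` is Alfred, `false` is Betty. -/
abbrev Player := Bool

/-- A Phutball position: the ball's point `(column, row)`, the finite set of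
chaps, and the player whose turn it is. -/
structure PState where
  ball : ℤ × ℤ
  chaps : Finset (ℤ × ℤ)
  turn : Player
deriving DecidableEq

/-- The eight horizontal, vertical and diagonal directions. -/
def dirs : Finset (ℤ × ℤ) :=
  {(1, 0), (1, 1), (0, 1), (-1, 1), (-1, 0), (-1, -1), (0, -1), (1, -1)}

/-- The point reached from `b` after `i` steps in direction `d`. -/
def ray (b d : ℤ × ℤ) (i : ℤ) : ℤ × ℤ := (b.1 + i * d.1, b.2 + i * d.2)

/-- A point is on the `m × n` board. -/
def OnBoard (m n : ℤ) (p : ℤ × ℤ) : Prop :=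
  1 ≤ p.1 ∧ p.1 ≤ n ∧ 1 ≤ p.2 ∧ p.2 ≤ m

/-- A single hop on a board with `n` columns: the ball at `b` moves in one of the
eight directions `d` over a contiguous nonempty line of `k` chaps, landing on the
first point beyond them that carries no chap; the jumped-over chaps are removed.
The landing point must not lie onto or past the sidelines (outside columns
`1, …, n`), but it may lie past the top or bottom row. -/
def Hop (n : ℤ) (b : ℤ × ℤ) (c : Finset (ℤ × ℤ)) (b' : ℤ × ℤ) (c' : Finset (ℤ × ℤ)) : Prop :=
  ∃ d ∈ dirs, ∃ k : ℕ, 1 ≤ k ∧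
    (∀ i : ℕ, 1 ≤ i → i ≤ k → ray b d i ∈ c) ∧
    ray b d (k + 1) ∉ c ∧
    1 ≤ (ray b d (k + 1)).1 ∧ (ray b d (k + 1)).1 ≤ n ∧
    b' = ray b d (k + 1) ∧
    c' = c \ Finset.image (fun i : ℕ => ray b d i) (Finset.Icc 1 k)

/-- A jump is a nonempty sequence of hops (the player may stop after any hop,
and the removed chaps cannot be re-used by later hops of the same jump).  The
jump can continue after a hop only if the ball has not been carried past the top
or bottom row (which would end the game immediately). -/
inductive Jump (m n : ℤ) : ℤ × ℤ → Finset (ℤ × ℤ) → ℤ × ℤ → Finset (ℤ × ℤ) → Prop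
  | single {b c b' c'} : Hop n b c b' c' → Jump m n b c b' c'
  | cons {b c b₁ c₁ b' c'} : Hop n b c b₁ c₁ → 1 ≤ b₁.2 → b₁.2 ≤ m →
      Jump m n b₁ c₁ b' c' → Jump m n b c b' c'

/-- The winner, if any, of a position (evaluated between turns): Alfred wins if
the ball rests on the top row `m` or has been carried past it; Betty wins if the
ball rests on the bottom row `1` or has been carried past it. -/
def winner (m : ℤ) (s : PState) : Option Player :=
  if m ≤ s.ball.2 then some true else if s.ball.2 ≤ 1 then some false else none

/-- A single legal move on the `m × n` board: the player to move either places a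
chap on a vacant on-board point, or moves the ball by a jump; the turn passes to
the other player. -/
def MoveRel (m n : ℤ) (s t : PState) : Prop :=
  t.turn = !s.turn ∧
    ((∃ p, OnBoard m n p ∧ p ∉ s.chaps ∧ p ≠ s.ball ∧
        t.ball = s.ball ∧ t.chaps = insert p s.chaps) ∨
      Jump m n s.ball s.chaps t.ball t.chaps)

/-- An infinite record of play: while the game is not over and a legal move
exists, a legal move is made; otherwise the position is frozen forever. -/
def IsPlay (m n : ℤ) (f : ℕ → PState) : Prop :=
  ∀ k,
    (winner m (f k) = none ∧ (∃ t, MoveRel m n (f k) t) ∧ MoveRel m n (f k) (f (k + 1))) ∨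
    ((winner m (f k) ≠ none ∨ ¬ ∃ t, MoveRel m n (f k) t) ∧ f (k + 1) = f k)

/-- A strategy for player `p` that always proposes a legal move whenever the game
is not over, it is `p`'s turn, and some legal move exists. -/
def LegalStrategy (m n : ℤ) (p : Player) (σ : PState → PState) : Prop :=
  ∀ s, s.turn = p → winner m s = none → (∃ t, MoveRel m n s t) → MoveRel m n s (σ s)

/-- The play `f` follows the strategy `σ` of player `p`. -/
def Follows (m n : ℤ) (p : Player) (σ : PState → PState) (f : ℕ → PState) : Prop :=
  ∀ k, (f k).turn = p → winner m (f k) = none → (∃ t, MoveRel m n (f k) t) →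
    f (k + 1) = σ (f k)

/-- Player `p` has a winning strategy from `s₀` on the `m × n` board: a legal
strategy guaranteeing that, against every play of the opponent, `p` wins after
finitely many moves. -/
def WinsFrom (m n : ℤ) (p : Player) (s₀ : PState) : Prop :=
  ∃ σ, LegalStrategy m n p σ ∧
    ∀ f, IsPlay m n f → f 0 = s₀ → Follows m n p σ f → ∃ k, winner m (f k) = some p

/-- Player `p` has a drawing strategy from `s₀` on the `m × n` board: a legal
strategy guaranteeing that the opponent never wins (play may continue forever). -/
def DrawsFrom (m n : ℤ) (p : Player) (s₀ : PState) : Prop :=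
  ∃ σ, LegalStrategy m n p σ ∧
    ∀ f, IsPlay m n f → f 0 = s₀ → Follows m n p σ f → ∀ k, winner m (f k) ≠ some (!p)

/-- A position is drawn if both players have drawing strategies from it. -/
def Drawn (m n : ℤ) (s : PState) : Prop :=
  DrawsFrom m n true s ∧ DrawsFrom m n false s

/-- The 24 chaps of the position `P0` on the 12 × 10 board:
c1, c2, c5, c7, c9, c10, c11, c12, d6, e4, e11, e12, f1, f2, f9, g7,
h1, h2, h3, h4, h6, h8, h11, h12. -/
def P0chaps : Finset (ℤ × ℤ) :=
  {(3, 1), (3, 2), (3, 5), (3, 7), (3, 9), (3, 10), (3, 11), (3, 12), (4, 6), (5, 4), (5, 11), (5, 12), (6, 1), (6, 2), (6, 9), (7, 7), (8, 1), (8, 2), (8, 3), (8, 4), (8, 6), (8, 8), (8, 11), (8, 12)}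

/-- The position `P0`: ball at a2 = (1, 2), the 24 chaps above, Alfred to move. -/
def P0 : PState := ⟨(1, 2), P0chaps, true⟩

/-- The position `P7`: `P0` with additional chaps at b3, c4, d5, e6, f7, g8, h9, with Betty to move. -/
def P7 : PState := ⟨(1, 2), P0chaps ∪ {(2, 3), (3, 4), (4, 5), (5, 6), (6, 7), (7, 8), (8, 9)}, false⟩

/-- The result of Betty placing a chap at i10 = (9, 10) from `P7`. -/
def P7_i10 : PState := ⟨(1, 2), insert (9, 10) P7.chaps, true⟩

/-! ### Bitboard encoding -/

/-- The point with index `i`: column `i % 16`, row `i / 16`. -/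
def pt (i : ℕ) : ℤ × ℤ := ((i % 16 : ℕ), (i / 16 : ℕ))

/-- The index `i` is that of a point of the `12 × 10` board. -/
def OnB (i : ℕ) : Prop := 1 ≤ i % 16 ∧ i % 16 ≤ 10 ∧ 1 ≤ i / 16 ∧ i / 16 ≤ 12

/-- The bitboard `c` only has bits at points of the board. -/
def Inside (c : ℕ) : Prop := ∀ i, c.testBit i = true → OnB i

/-- The set of points encoded by a bitboard. -/
def chapSet (c : ℕ) : Finset (ℤ × ℤ) :=
  ((Finset.range 208).filter fun i => c.testBit i = true).image pt

/-- The position encoded by a ball index, a bitboard and a turn. -/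
def toState (b c : ℕ) (q : Player) : PState := ⟨pt b, chapSet c, q⟩

theorem pt_injective : Function.Injective pt := by
  intro i j h
  simp only [pt, Prod.mk.injEq, Nat.cast_inj] at h
  omega

theorem OnB.lt {i : ℕ} (h : OnB i) : i < 208 := by
  unfold OnB at h; omega

theorem mem_chapSet {c : ℕ} (hc : Inside c) {p : ℤ × ℤ} :
    p ∈ chapSet c ↔ ∃ i, c.testBit i = true ∧ pt i = p := by
  simp only [chapSet, Finset.mem_image, Finset.mem_filter, Finset.mem_range]
  exact ⟨fun ⟨i, hi, e⟩ => ⟨i, hi.2, e⟩, fun ⟨i, hi, e⟩ => ⟨i, ⟨(hc i hi).lt, hi⟩, e⟩⟩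

theorem pt_mem_chapSet {c : ℕ} (hc : Inside c) {i : ℕ} :
    pt i ∈ chapSet c ↔ c.testBit i = true := by
  rw [mem_chapSet hc]
  exact ⟨fun ⟨j, hj, e⟩ => pt_injective e ▸ hj, fun h => ⟨i, h, rfl⟩⟩

theorem onBoard_pt {i : ℕ} : OnBoard 12 10 (pt i) ↔ OnB i := by
  simp only [OnBoard, pt, OnB]; omega

theorem exists_pt {p : ℤ × ℤ} (h : OnBoard 12 10 p) : ∃ i, OnB i ∧ pt i = p := by
  obtain ⟨x, y⟩ := p
  simp only [OnBoard] at h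
  refine ⟨16 * y.toNat + x.toNat, ?_, ?_⟩
  · simp only [OnB]; omega
  · simp only [pt, Prod.mk.injEq]; omega

theorem testBit_lor_two_pow (c i x : ℕ) :
    (Nat.lor c (Nat.pow 2 i)).testBit x = true ↔ c.testBit x = true ∨ x = i := by
  change (c ||| 2 ^ i).testBit x = true ↔ _
  rw [Nat.testBit_lor, Nat.testBit_two_pow]
  simp [eq_comm (a := i)]

theorem Inside.lor {c i : ℕ} (hc : Inside c) (hi : OnB i) :
    Inside (Nat.lor c (Nat.pow 2 i)) := by
  intro x hx
  rcases (testBit_lor_two_pow c i x).1 hx with h | rfl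
  exacts [hc x h, hi]

theorem chapSet_lor {c i : ℕ} (hc : Inside c) (hi : OnB i) :
    chapSet (Nat.lor c (Nat.pow 2 i)) = insert (pt i) (chapSet c) := by
  ext p
  simp only [mem_chapSet (hc.lor hi), Finset.mem_insert, mem_chapSet hc, testBit_lor_two_pow]
  constructor
  · rintro ⟨x, h | rfl, rfl⟩
    exacts [.inr ⟨x, h, rfl⟩, .inl rfl]
  · rintro (rfl | ⟨x, h, rfl⟩)
    exacts [⟨i, .inr rfl, rfl⟩, ⟨x, .inl h, rfl⟩]

/-! ### Hops on bitboards -/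

/-- Codes of the eight directions: `(dx + 1) + 16 * (dy + 1)`. -/
def dirCodes : List ℕ := [18, 34, 33, 32, 16, 0, 1, 2]

/-- The direction with code `o`. -/
def dirOf (o : ℕ) : ℤ × ℤ := ((o % 16 : ℕ) - 1, (o / 16 : ℕ) - 1)

/-- The index of the neighbour of `b` in the direction coded by `o`. -/
def step (o b : ℕ) : ℕ := Nat.sub (Nat.add b o) 17

theorem dirOf_mem {o : ℕ} (ho : o ∈ dirCodes) : dirOf o ∈ dirs := by
  revert o; decide

theorem exists_dirCode {d : ℤ × ℤ} (hd : d ∈ dirs) : ∃ o ∈ dirCodes, dirOf o = d := by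
  revert d; decide

theorem pt_step {o b : ℕ} (ho : o ∈ dirCodes) (hb : OnB b) :
    pt (step o b) = ((pt b).1 + (dirOf o).1, (pt b).2 + (dirOf o).2) := by
  have e : step o b = b + o - 17 := rfl
  simp only [pt, dirOf, e, Prod.mk.injEq]
  simp only [OnB] at hb
  simp only [dirCodes, List.mem_cons, List.not_mem_nil, or_false] at ho
  rcases ho with rfl | rfl | rfl | rfl | rfl | rfl | rfl | rfl <;> omega

theorem pt_step_iterate {o b : ℕ} (ho : o ∈ dirCodes) (k : ℕ)
    (h : ∀ i, i < k → OnB ((step o)^[i] b)) :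
    pt ((step o)^[k] b) = ray (pt b) (dirOf o) k := by
  induction k with
  | zero => simp [ray]
  | succ k ih =>
    rw [Function.iterate_succ_apply', pt_step ho (h k k.lt_succ_self),
      ih fun i hi => h i (hi.trans k.lt_succ_self)]
    simp only [ray, Prod.mk.injEq]
    push_cast
    constructor <;> ring

/-- From `b`, direction `o` meets a line of exactly `j ≥ 1` chaps, followed by a landing
index in the columns of the board. -/
def Run (o b c j : ℕ) : Prop :=
  1 ≤ j ∧ (∀ i, 1 ≤ i → i ≤ j → c.testBit ((step o)^[i] b) = true) ∧
    c.testBit ((step o)^[j + 1] b) = false ∧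
    1 ≤ (step o)^[j + 1] b % 16 ∧ (step o)^[j + 1] b % 16 ≤ 10

/-- `c'` is `c` with the `j` points after `b` in direction `o` removed. -/
def Clears (o b c j c' : ℕ) : Prop :=
  ∀ x, c'.testBit x = true ↔
    c.testBit x = true ∧ ∀ i, 1 ≤ i → i ≤ j → x ≠ (step o)^[i] b

theorem Clears.inside {o b c j c' : ℕ} (h : Clears o b c j c') (hc : Inside c) : Inside c' :=
  fun x hx => hc x ((h x).1 hx).1

theorem Run.pt_iterate {o b c j : ℕ} (h : Run o b c j) (ho : o ∈ dirCodes) (hb : OnB b)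
    (hc : Inside c) {i : ℕ} (hi : i ≤ j + 1) :
    pt ((step o)^[i] b) = ray (pt b) (dirOf o) i := by
  refine pt_step_iterate ho i fun i' hi' => ?_
  rcases Nat.eq_zero_or_pos i' with rfl | hp
  · exact hb
  · exact hc _ (h.2.1 i' hp (by omega))

theorem Clears.chapSet_eq {o b c j c' : ℕ} (h : Clears o b c j c') (hr : Run o b c j)
    (ho : o ∈ dirCodes) (hb : OnB b) (hc : Inside c) :
    chapSet c' = chapSet c \
      Finset.image (fun i : ℕ => ray (pt b) (dirOf o) i) (Finset.Icc 1 j) := by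
  ext p
  simp only [mem_chapSet (h.inside hc), Finset.mem_sdiff, mem_chapSet hc, Finset.mem_image,
    Finset.mem_Icc, h _]
  constructor
  · rintro ⟨x, ⟨hx, hn⟩, rfl⟩
    refine ⟨⟨x, hx, rfl⟩, ?_⟩
    rintro ⟨i, ⟨h1, h2⟩, e⟩
    rw [← hr.pt_iterate ho hb hc (by omega)] at e
    exact hn i h1 h2 (pt_injective e).symm
  · rintro ⟨⟨x, hx, rfl⟩, hn⟩
    refine ⟨x, ⟨hx, fun i h1 h2 e => hn ⟨i, ⟨h1, h2⟩, ?_⟩⟩, rfl⟩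
    rw [e, hr.pt_iterate ho hb hc (by omega)]

theorem Run.hop {o b c j c' : ℕ} (hr : Run o b c j) (h : Clears o b c j c')
    (ho : o ∈ dirCodes) (hb : OnB b) (hc : Inside c) :
    Hop 10 (pt b) (chapSet c) (pt ((step o)^[j + 1] b)) (chapSet c') := by
  have e := hr.pt_iterate ho hb hc le_rfl
  push_cast at e
  refine ⟨dirOf o, dirOf_mem ho, j, hr.1, fun i h1 h2 => ?_, ?_, ?_, ?_, e,
    h.chapSet_eq hr ho hb hc⟩
  · rw [← hr.pt_iterate ho hb hc (by omega), pt_mem_chapSet hc]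
    exact hr.2.1 i h1 h2
  · rw [← e, pt_mem_chapSet hc, hr.2.2.1]; simp
  · rw [← e]; simp only [pt]; have := hr.2.2.2.1; omega
  · rw [← e]; simp only [pt]; have := hr.2.2.2.2; omega

theorem exists_run_of_hop {b c : ℕ} {q : ℤ × ℤ} {s : Finset (ℤ × ℤ)} (hb : OnB b)
    (hc : Inside c) (h : Hop 10 (pt b) (chapSet c) q s) :
    ∃ o ∈ dirCodes, ∃ j, Run o b c j ∧ q = pt ((step o)^[j + 1] b) ∧
      ∀ c', Clears o b c j c' → s = chapSet c' := by
  obtain ⟨d, hd, j, hj, hline, hland, hl, hu, rfl, rfl⟩ := h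
  obtain ⟨o, ho, rfl⟩ := exists_dirCode hd
  have key : ∀ k, k ≤ j → ∀ i, 1 ≤ i → i ≤ k → c.testBit ((step o)^[i] b) = true := by
    intro k
    induction k with
    | zero => intro _ i h1 h2; omega
    | succ k ih =>
      intro hk i h1 h2
      rcases Nat.lt_or_ge i (k + 1) with h3 | h3
      · exact ih (by omega) i h1 (by omega)
      · obtain rfl : i = k + 1 := by omega
        rw [← pt_mem_chapSet hc, pt_step_iterate ho (k + 1)]
        · exact hline _ h1 hk
        · intro i' hi'
          rcases Nat.eq_zero_or_pos i' with rfl | hp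
          · exact hb
          · exact hc _ (ih (by omega) i' hp (by omega))
  have e : pt ((step o)^[j + 1] b) = ray (pt b) (dirOf o) (j + 1) := by
    have := pt_step_iterate (b := b) ho (j + 1) fun i hi => by
      rcases Nat.eq_zero_or_pos i with rfl | hp
      · exact hb
      · exact hc _ (key j le_rfl i hp (by omega))
    push_cast at this
    exact this
  have hr : Run o b c j := by
    refine ⟨hj, key j le_rfl, ?_, ?_, ?_⟩
    · rw [← e, pt_mem_chapSet hc] at hland; simpa using hland
    · rw [← e] at hl; simp only [pt] at hl; omega
    · rw [← e] at hu; simp only [pt] at hu; omega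
  exact ⟨o, ho, j, hr, e.symm, fun c' hc' => (hc'.chapSet_eq hr ho hb hc).symm⟩

/-! ### Executable hops -/

/-- Bit `i` of `c`, in a form that evaluates quickly. -/
def bit (c i : ℕ) : Bool := Nat.beq (Nat.land 1 (Nat.shiftRight c i)) 1

theorem bit_eq_testBit (c i : ℕ) : bit c i = c.testBit i := by
  change Nat.beq (1 &&& (c >>> i)) 1 = _
  rw [Nat.testBit, Nat.one_and_eq_mod_two, Bool.eq_iff_iff, Nat.beq_eq]
  simp

/-- Advance from `b` past the chaps of `c` in direction `o`, removing them from `d`, and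
apply `k` to the landing index and the remaining chaps. -/
def slide (o c : ℕ) (k : ℕ → ℕ → Bool) : ℕ → ℕ → ℕ → Bool
  | 0, _, _ => false
  | n + 1, b, d =>
    bif bit c b then
      slide o c k n (step o b) (Nat.xor (Nat.lor d (Nat.pow 2 b)) (Nat.pow 2 b))
    else k b d

theorem exists_of_slide {o c : ℕ} {k : ℕ → ℕ → Bool} {n b d : ℕ}
    (h : slide o c k n b d = true) :
    ∃ j d', (∀ i, i < j → c.testBit ((step o)^[i] b) = true) ∧
      c.testBit ((step o)^[j] b) = false ∧
      (∀ x, d'.testBit x = true ↔ d.testBit x = true ∧ ∀ i, i < j → x ≠ (step o)^[i] b) ∧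
      k ((step o)^[j] b) d' = true := by
  induction n generalizing b d with
  | zero => simp [slide] at h
  | succ n ih =>
    rw [slide, bit_eq_testBit] at h
    cases hb : c.testBit b
    · rw [hb] at h
      exact ⟨0, d, by simp, hb, by simp, h⟩
    · rw [hb] at h
      obtain ⟨j, d', h1, h2, h3, h4⟩ := ih h
      refine ⟨j + 1, d', fun i hi => ?_, h2, fun x => ?_, h4⟩
      · cases i with
        | zero => exact hb
        | succ i => exact h1 i (by omega)
      · have hx : (Nat.xor (Nat.lor d (Nat.pow 2 b)) (Nat.pow 2 b)).testBit x = true ↔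
            d.testBit x = true ∧ x ≠ b := by
          change ((d ||| 2 ^ b) ^^^ 2 ^ b).testBit x = true ↔ _
          rw [Nat.testBit_xor, Nat.testBit_lor, Nat.testBit_two_pow]
          by_cases e : x = b
          · simp [e]
          · simp [e, Ne.symm e]
        rw [h3, hx]
        constructor
        · rintro ⟨⟨hd, hne⟩, hi⟩
          refine ⟨hd, fun i hi' => ?_⟩
          cases i with
          | zero => exact hne
          | succ i => exact hi i (by omega)
        · rintro ⟨hd, hi⟩
          exact ⟨⟨hd, hi 0 (by omega)⟩, fun i hi' => hi (i + 1) (by omega)⟩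

/-- The index `b` lies in a column of the board. -/
def inColumns (b : ℕ) : Bool := Nat.ble 1 (Nat.mod b 16) && Nat.ble (Nat.mod b 16) 10

/-- The index `b` lies in a row of the board. -/
def inRows (b : ℕ) : Bool := Nat.ble 16 b && Nat.ble b 207

theorem inColumns_iff {b : ℕ} : inColumns b = true ↔ 1 ≤ b % 16 ∧ b % 16 ≤ 10 := by
  rw [inColumns, Bool.and_eq_true, Nat.ble_eq, Nat.ble_eq]; rfl

theorem inRows_iff {b : ℕ} : inRows b = true ↔ 16 ≤ b ∧ b ≤ 207 := by
  rw [inRows, Bool.and_eq_true, Nat.ble_eq, Nat.ble_eq]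

theorem onB_of_inRows {b : ℕ} (h : inRows b = true) (hc : 1 ≤ b % 16 ∧ b % 16 ≤ 10) : OnB b := by
  rw [inRows_iff] at h; simp only [OnB]; omega

/-- Apply `k` to the outcome of the hop in direction `o`; return `e` if there is none. -/
def tryHop (o b c : ℕ) (e : Bool) (k : ℕ → ℕ → Bool) : Bool :=
  bif bit c (step o b) then
    slide o c (fun b' c' => bif inColumns b' then k b' c' else e) 13 (step o b) c
  else e

theorem exists_run_of_tryHop {o b c : ℕ} {k : ℕ → ℕ → Bool} (h : tryHop o b c false k = true) :
    ∃ j c', Run o b c j ∧ Clears o b c j c' ∧ k ((step o)^[j + 1] b) c' = true := by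
  rw [tryHop, bit_eq_testBit] at h
  cases hb : c.testBit (step o b)
  · simp [hb] at h
  rw [hb] at h
  obtain ⟨j, d', h1, h2, h3, h4⟩ := exists_of_slide h
  have hj : j ≠ 0 := by rintro rfl; simp [hb] at h2
  cases hcol : inColumns ((step o)^[j] (step o b))
  · simp [hcol] at h4
  refine ⟨j, d', ⟨by omega, fun i hi1 hi2 => ?_, h2, inColumns_iff.1 hcol⟩, fun x => ?_, ?_⟩
  · obtain ⟨i, rfl⟩ := Nat.exists_eq_add_of_le' hi1
    exact h1 i (by omega)
  · rw [h3]
    refine and_congr_right fun _ => ⟨fun H i hi1 hi2 => ?_, fun H i hi => H (i + 1) (by omega) hi⟩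
    obtain ⟨i, rfl⟩ := Nat.exists_eq_add_of_le' hi1
    exact H i (by omega)
  · simpa [hcol] using h4

theorem exists_clears_of_tryHop {o b c j : ℕ} {k : ℕ → ℕ → Bool}
    (h : tryHop o b c true k = true) (hr : Run o b c j) :
    ∃ c', Clears o b c j c' ∧ k ((step o)^[j + 1] b) c' = true := by
  obtain ⟨hj, hline, hland, hcol⟩ := hr
  have hb : c.testBit (step o b) = true := hline 1 le_rfl hj
  rw [tryHop, bit_eq_testBit, hb] at h
  obtain ⟨j', d', h1, h2, h3, h4⟩ := exists_of_slide h
  obtain rfl : j' = j := by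
    rcases lt_trichotomy j' j with hlt | rfl | hlt
    · have := hline (j' + 1) (by omega) (by omega)
      rw [Function.iterate_succ_apply, h2] at this
      cases this
    · rfl
    · have := h1 j hlt
      rw [← Function.iterate_succ_apply, hland] at this
      cases this
  refine ⟨d', fun x => ?_, ?_⟩
  · rw [h3]
    refine and_congr_right fun _ => ⟨fun H i hi1 hi2 => ?_, fun H i hi => H (i + 1) (by omega) hi⟩
    obtain ⟨i, rfl⟩ := Nat.exists_eq_add_of_le' hi1
    exact H i (by omega)
  · have := inColumns_iff.2 hcol
    rw [Function.iterate_succ_apply] at this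
    simpa [this] using h4

/-- Does `g` hold at the outcome of every jump (of fewer than `n` hops) from `b`? -/
def allJumps (g : ℕ → ℕ → Bool) : ℕ → ℕ → ℕ → Bool
  | 0, _, _ => false
  | n + 1, b, c =>
    dirCodes.all fun o => tryHop o b c true fun b' c' =>
      g b' c' && bif inRows b' then allJumps g n b' c' else true

theorem exists_of_allJumps {g : ℕ → ℕ → Bool} {q₀ q : ℤ × ℤ} {s₀ s : Finset (ℤ × ℤ)}
    (hJ : Jump 12 10 q₀ s₀ q s) {n b c : ℕ} (hq : q₀ = pt b) (hs : s₀ = chapSet c)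
    (hb : OnB b) (hc : Inside c) (h : allJumps g n b c = true) :
    ∃ b' c', q = pt b' ∧ s = chapSet c' ∧ Inside c' ∧ (1 ≤ b' % 16 ∧ b' % 16 ≤ 10) ∧
      g b' c' = true := by
  induction hJ generalizing n b c with
  | single hop =>
    subst hq hs
    obtain ⟨o, ho, j, hr, rfl, hcl⟩ := exists_run_of_hop hb hc hop
    cases n with
    | zero => simp [allJumps] at h
    | succ n =>
      rw [allJumps, List.all_eq_true] at h
      obtain ⟨c', hc', hg⟩ := exists_clears_of_tryHop (h o ho) hr
      rw [Bool.and_eq_true] at hg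
      exact ⟨_, c', rfl, hcl c' hc', hc'.inside hc, hr.2.2.2, hg.1⟩
  | cons hop hl hu _ ih =>
    subst hq hs
    obtain ⟨o, ho, j, hr, rfl, hcl⟩ := exists_run_of_hop hb hc hop
    cases n with
    | zero => simp [allJumps] at h
    | succ n =>
      rw [allJumps, List.all_eq_true] at h
      obtain ⟨c', hc', hg⟩ := exists_clears_of_tryHop (h o ho) hr
      have hrow : inRows ((step o)^[j + 1] b) = true := by
        rw [inRows_iff]; simp only [pt] at hl hu; omega
      rw [Bool.and_eq_true, hrow] at hg
      exact ih rfl (hcl c' hc') (onB_of_inRows hrow hr.2.2.2) (hc'.inside hc) hg.2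

/-- The indices of the points of the board. -/
def cells : List ℕ :=
  [17, 33, 49, 65, 81, 97, 113, 129, 145, 161, 177, 193].flatMap fun r =>
    [r, r + 1, r + 2, r + 3, r + 4, r + 5, r + 6, r + 7, r + 8, r + 9]

theorem mem_cells {i : ℕ} (h : OnB i) : i ∈ cells := by
  have H : ∀ i < 208, (1 ≤ i % 16 ∧ i % 16 ≤ 10 ∧ 1 ≤ i / 16 ∧ i / 16 ≤ 12) → i ∈ cells := by
    decide +kernel
  exact H i h.lt h

/-- Is `z` a vacant point of the board? -/
def vacant (b c z : ℕ) : Bool :=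
  !bit c z && !Nat.beq z b && inRows z && inColumns z

theorem vacant_iff {b c z : ℕ} :
    vacant b c z = true ↔ c.testBit z = false ∧ z ≠ b ∧ OnB z := by
  simp only [vacant, Bool.and_eq_true, Bool.not_eq_true', bit_eq_testBit, inRows_iff,
    inColumns_iff, and_assoc]
  refine and_congr_right fun _ => and_congr ?_ ?_
  · rw [← Bool.not_eq_true, Nat.beq_eq]
  · simp only [OnB]; omega

theorem moveRel_place {b c z : ℕ} {q : Player} (hc : Inside c) (h : vacant b c z = true) :
    MoveRel 12 10 (toState b c q) (toState b (Nat.lor c (Nat.pow 2 z)) (!q)) := by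
  obtain ⟨h1, h2, h3⟩ := vacant_iff.1 h
  refine ⟨rfl, .inl ⟨pt z, onBoard_pt.2 h3, ?_, fun e => h2 (pt_injective e), rfl,
    chapSet_lor hc h3⟩⟩
  change pt z ∉ chapSet c
  rw [pt_mem_chapSet hc, h1]; simp

/-- Does `g` hold after every jump from `b`, and after every placement of a chap on a vacant
point in the list `zs`? -/
def replies (g : ℕ → ℕ → Bool) (zs : List ℕ) (b c : ℕ) : Bool :=
  allJumps g 20 b c &&
    zs.all fun z => bif vacant b c z then g b (Nat.lor c (Nat.pow 2 z)) else true

theorem exists_of_replies {g : ℕ → ℕ → Bool} {zs : List ℕ} {b c : ℕ} {q : Player} {t : PState}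
    (hb : OnB b) (hc : Inside c) (h : replies g zs b c = true)
    (ht : MoveRel 12 10 (toState b c q) t) :
    (∃ b' c', t = toState b' c' (!q) ∧ Inside c' ∧ (1 ≤ b' % 16 ∧ b' % 16 ≤ 10) ∧
      g b' c' = true) ∨
    ∃ z, vacant b c z = true ∧ z ∉ zs ∧ t = toState b (Nat.lor c (Nat.pow 2 z)) (!q) := by
  obtain ⟨t1, t2, t3⟩ := t
  rw [replies, Bool.and_eq_true, List.all_eq_true] at h
  obtain ⟨rfl, ⟨p, hp, hpc, hpb, rfl, rfl⟩ | hJ⟩ := ht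
  · obtain ⟨z, hz, rfl⟩ := exists_pt hp
    have hv : vacant b c z = true := by
      rw [vacant_iff]
      refine ⟨?_, fun e => hpb (e ▸ rfl), hz⟩
      have := (pt_mem_chapSet hc).not.1 hpc
      simpa using this
    have e : (⟨pt b, insert (pt z) (chapSet c), !q⟩ : PState) =
        toState b (Nat.lor c (Nat.pow 2 z)) (!q) := by
      rw [toState, chapSet_lor hc hz]
    by_cases hzs : z ∈ zs
    · have hg := h.2 z hzs
      rw [hv] at hg
      refine .inl ⟨b, _, e, hc.lor hz, ?_, hg⟩
      exact ⟨hb.1, hb.2.1⟩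
    · exact .inr ⟨z, hv, hzs, e⟩
  · obtain ⟨b', c', rfl, rfl, hc', hcol, hg⟩ := exists_of_allJumps hJ rfl rfl hb hc h.1
    exact .inl ⟨b', c', rfl, hc', hcol, hg⟩

/-! ### Winning in a bounded number of moves -/

/-- Player `p` can force a win from `s` within `k` moves. -/
def Wins (m n : ℤ) (p : Player) : ℕ → PState → Prop
  | 0, s => winner m s = some p
  | k + 1, s => winner m s = some p ∨ winner m s = none ∧ (∃ t, MoveRel m n s t) ∧
      (s.turn = p ∧ (∃ t, MoveRel m n s t ∧ Wins m n p k t) ∨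
        s.turn ≠ p ∧ ∀ t, MoveRel m n s t → Wins m n p k t)

theorem Wins.succ {m n : ℤ} {p : Player} {k : ℕ} {s : PState} (h : Wins m n p k s) :
    Wins m n p (k + 1) s := by
  induction k generalizing s with
  | zero => exact .inl h
  | succ k ih =>
    rcases h with h | ⟨hw, he, ⟨ht, t, hm, h⟩ | ⟨ht, h⟩⟩
    · exact .inl h
    · exact .inr ⟨hw, he, .inl ⟨ht, t, hm, ih h⟩⟩
    · exact .inr ⟨hw, he, .inr ⟨ht, fun t hm => ih (h t hm)⟩⟩

theorem Wins.mono {m n : ℤ} {p : Player} {k l : ℕ} (hkl : k ≤ l) {s : PState}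
    (h : Wins m n p k s) : Wins m n p l s := by
  induction hkl with
  | refl => exact h
  | step _ ih => exact ih.succ

theorem Wins.of_move {m n : ℤ} {p : Player} {k : ℕ} {s t : PState} (hw : winner m s = none)
    (ht : s.turn = p) (hm : MoveRel m n s t) (h : Wins m n p k t) : Wins m n p (k + 1) s :=
  .inr ⟨hw, ⟨t, hm⟩, .inl ⟨ht, t, hm, h⟩⟩

open Classical in
theorem exists_nearest_win (m n : ℤ) (p : Player) (s : PState) (ht : s.turn = p)
    (hw : winner m s = none) (he : ∃ t, MoveRel m n s t) :
    ∃ t, MoveRel m n s t ∧ ∀ k, Wins m n p k s → ∃ l < k, Wins m n p l t := by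
  by_cases h : ∃ k, Wins m n p k s
  · have hk := Nat.find_spec h
    have hmin : ∀ k, Wins m n p k s → Nat.find h ≤ k := fun k hk => Nat.find_min' h hk
    cases e : Nat.find h with
    | zero => rw [e] at hk; rw [Wins, hw] at hk; cases hk
    | succ l =>
      rw [e] at hk hmin
      rcases hk with hk | ⟨_, _, ⟨_, t, hm, hl⟩ | ⟨hne, _⟩⟩
      · rw [hw] at hk; cases hk
      · exact ⟨t, hm, fun k hk => ⟨l, hmin k hk, hl⟩⟩
      · exact absurd ht hne
  · obtain ⟨t, hm⟩ := he
    exact ⟨t, hm, fun k hk => absurd ⟨k, hk⟩ h⟩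

open Classical in
theorem Wins.winsFrom {m n : ℤ} {p : Player} {k : ℕ} {s : PState} (h : Wins m n p k s) :
    WinsFrom m n p s := by
  choose! σ hσ hσ' using exists_nearest_win m n p
  refine ⟨σ, fun s ht hw he => hσ s ht hw he, fun f hf h0 hfol => ?_⟩
  have key : ∀ k i, Wins m n p k (f i) → ∃ i, winner m (f i) = some p := by
    intro k
    induction k using Nat.strong_induction_on with
    | _ k ih =>
      intro i hi
      cases k with
      | zero => exact ⟨i, hi⟩
      | succ k =>
        rcases id hi with hi' | ⟨hw, he, ⟨ht, _⟩ | ⟨_, hall⟩⟩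
        · exact ⟨i, hi'⟩
        · obtain ⟨l, hl, hwin⟩ := hσ' _ ht hw he _ hi
          exact ih l hl (i + 1) (hfol i ht hw he ▸ hwin)
        · rcases hf i with ⟨_, _, hm⟩ | ⟨hn | hn, _⟩
          · exact ih k k.lt_succ_self (i + 1) (hall _ hm)
          · exact absurd hw hn
          · exact absurd he hn
  exact key k 0 (h0 ▸ h)

/-- A player `p` who can always stay inside a set of positions that are not yet lost
prevents the opponent from having a winning strategy. -/
theorem not_winsFrom_of_safe {m n : ℤ} {p : Player} (S : Set PState)
    (hlost : ∀ s ∈ S, winner m s ≠ some p)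
    (htheirs : ∀ s ∈ S, winner m s = none → s.turn = p → ∀ t, MoveRel m n s t → t ∈ S)
    (hours : ∀ s ∈ S, winner m s = none → s.turn ≠ p → (∃ t, MoveRel m n s t) →
      ∃ t ∈ S, MoveRel m n s t)
    {s₀ : PState} (h₀ : s₀ ∈ S) : ¬ WinsFrom m n p s₀ := by
  classical
  rintro ⟨σ, hσ, hwin⟩
  have hnext : ∀ s, ∃ t, s ∈ S → t ∈ S ∧
      ((winner m s = none ∧ (∃ t, MoveRel m n s t) ∧ MoveRel m n s t) ∨
        ((winner m s ≠ none ∨ ¬ ∃ t, MoveRel m n s t) ∧ t = s)) ∧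
      (s.turn = p → winner m s = none → (∃ t, MoveRel m n s t) → t = σ s) := by
    intro s
    by_cases hs : s ∈ S
    swap
    · exact ⟨s, fun h => absurd h hs⟩
    by_cases hw : winner m s = none
    swap
    · exact ⟨s, fun _ => ⟨hs, .inr ⟨.inl hw, rfl⟩, fun _ h => absurd h hw⟩⟩
    by_cases he : ∃ t, MoveRel m n s t
    swap
    · exact ⟨s, fun _ => ⟨hs, .inr ⟨.inr he, rfl⟩, fun _ _ h => absurd h he⟩⟩
    by_cases ht : s.turn = p
    · have hm := hσ s ht hw he
      exact ⟨σ s, fun _ => ⟨htheirs s hs hw ht _ hm, .inl ⟨hw, he, hm⟩, fun _ _ _ => rfl⟩⟩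
    · obtain ⟨t, htS, hm⟩ := hours s hs hw ht he
      exact ⟨t, fun _ => ⟨htS, .inl ⟨hw, he, hm⟩, fun h => absurd h ht⟩⟩
  choose nxt hnxt using hnext
  let f : ℕ → PState := fun k => nxt^[k] s₀
  have hsucc : ∀ k, f (k + 1) = nxt (f k) := fun k => Function.iterate_succ_apply' nxt k s₀
  have hf : ∀ k, f k ∈ S := by
    intro k
    induction k with
    | zero => exact h₀
    | succ k ih => rw [hsucc]; exact (hnxt _ ih).1
  obtain ⟨k, hk⟩ := hwin f (fun k => by rw [hsucc]; exact (hnxt _ (hf k)).2.1) rfl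
    (fun k => by rw [hsucc]; exact (hnxt _ (hf k)).2.2)
  exact hlost _ (hf k) hk

/-! ### Strategy trees -/

/-- Does a ball at rest at `b` win the game for `p`? -/
def goal (p : Player) (b : ℕ) : Bool := bif p then Nat.ble 192 b else Nat.ble b 31

theorem winner_toState (b c : ℕ) (q : Player) :
    winner 12 (toState b c q) =
      if (12 : ℤ) ≤ (b / 16 : ℕ) then some true
      else if ((b / 16 : ℕ) : ℤ) ≤ 1 then some false else none := rfl

theorem winner_of_goal {p : Player} {b : ℕ} (c : ℕ) (q : Player) (h : goal p b = true) :
    winner 12 (toState b c q) = some p := by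
  rw [winner_toState]
  cases p
  · have : b ≤ 31 := Nat.le_of_ble_eq_true h
    rw [if_neg (by omega), if_pos (by omega)]
  · have : 192 ≤ b := Nat.le_of_ble_eq_true h
    rw [if_pos (by omega)]

theorem not_le_of_goal {p : Player} {b : ℕ} (h₁ : goal p b = false) (h₂ : goal (!p) b = false) :
    ¬ 192 ≤ b ∧ ¬ b ≤ 31 := by
  rw [← Nat.ble_eq, ← Nat.ble_eq]
  cases p <;> simp_all [goal]

theorem winner_eq_none {p : Player} {b : ℕ} (c : ℕ) (q : Player) (h₁ : goal p b = false)
    (h₂ : goal (!p) b = false) : winner 12 (toState b c q) = none := by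
  have h := not_le_of_goal h₁ h₂
  rw [winner_toState, if_neg (by omega), if_neg (by omega)]

theorem onB_of_goal {p : Player} {b : ℕ} (h₁ : goal p b = false) (h₂ : goal (!p) b = false)
    (hcol : 1 ≤ b % 16 ∧ b % 16 ≤ 10) : OnB b := by
  have h := not_le_of_goal h₁ h₂
  simp only [OnB]; omega

/-- A sequence of hops from `b`, `c` to `b'`, `c'` with the given landing points. -/
inductive Route : ℕ → ℕ → List ℕ → ℕ → ℕ → Prop
  | nil (b c) : Route b c [] b c
  | cons {o b c j c₁ L b' c'} : OnB b → o ∈ dirCodes → Run o b c j → Clears o b c j c₁ →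
      Route ((step o)^[j + 1] b) c₁ L b' c' → Route b c ((step o)^[j + 1] b :: L) b' c'

theorem Route.jump {b c b' c' : ℕ} {L : List ℕ} (h : Route b c L b' c') (hc : Inside c) :
    b' = b ∨ OnB b ∧ Jump 12 10 (pt b) (chapSet c) (pt b') (chapSet c') := by
  suffices (b' = b ∧ c' = c) ∨ OnB b ∧ Jump 12 10 (pt b) (chapSet c) (pt b') (chapSet c') from
    this.imp_left And.left
  induction h with
  | nil b c => exact .inl ⟨rfl, rfl⟩
  | cons hb ho hr hcl _ ih =>
    have hop := hr.hop hcl ho hb hc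
    rcases ih (hcl.inside hc) with ⟨rfl, rfl⟩ | ⟨hb', hJ⟩
    · exact .inr ⟨hb, .single hop⟩
    · have := onBoard_pt.2 hb'
      exact .inr ⟨hb, .cons hop this.2.2.1 this.2.2.2 hJ⟩

theorem Route.place {b c b' c' z : ℕ} {L : List ℕ} (h : Route b c L b' c')
    (hz : c.testBit z = false) (hL : z ∉ L) :
    ∃ c'', Route b (Nat.lor c (Nat.pow 2 z)) L b' c'' := by
  induction h with
  | nil b c => exact ⟨_, .nil _ _⟩
  | @cons o b c j c₁ L b' c' hb ho hr hcl _ ih =>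
    rw [List.mem_cons, not_or] at hL
    have hz₁ : c₁.testBit z = false := by
      rw [← Bool.not_eq_true, hcl]; simp [hz]
    obtain ⟨c'', h''⟩ := ih hz₁ hL.2
    refine ⟨c'', .cons hb ho ⟨hr.1, fun i h1 h2 => ?_, ?_, hr.2.2.2⟩ (fun x => ?_) h''⟩
    · exact (testBit_lor_two_pow _ _ _).2 (.inl (hr.2.1 i h1 h2))
    · rw [← Bool.not_eq_true, testBit_lor_two_pow, hr.2.2.1]
      simpa using Ne.symm hL.1
    · rw [testBit_lor_two_pow, testBit_lor_two_pow, hcl]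
      constructor
      · rintro (⟨h1, h2⟩ | rfl)
        · exact ⟨.inl h1, h2⟩
        · refine ⟨.inr rfl, fun i h1 h2 e => ?_⟩
          rw [e, hr.2.1 i h1 h2] at hz
          cases hz
      · rintro ⟨h1 | rfl, h2⟩
        exacts [.inl ⟨h1, h2⟩, .inr rfl]

/-- Hop along the directions in the list, collecting the landing points in front of `zs`, and
apply `k` to the outcome. -/
def follow (k : ℕ → List ℕ → Bool) : List ℕ → ℕ → ℕ → List ℕ → Bool
  | [], b, _, zs => k b zs
  | o :: os, b, c, zs =>
    dirCodes.any (Nat.beq o) && inRows b &&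
      tryHop o b c false fun b' c' => follow k os b' c' (b' :: zs)

theorem exists_of_follow {k : ℕ → List ℕ → Bool} {os zs : List ℕ} {b c : ℕ}
    (hcol : 1 ≤ b % 16 ∧ b % 16 ≤ 10) (h : follow k os b c zs = true) :
    ∃ b' c' L zs', Route b c L b' c' ∧ (∀ z ∈ L, z ∈ zs') ∧ (∀ z ∈ zs, z ∈ zs') ∧
      k b' zs' = true := by
  induction os generalizing b c zs with
  | nil => exact ⟨b, c, [], zs, .nil b c, by simp, fun _ h => h, h⟩
  | cons o os ih =>
    rw [follow, Bool.and_eq_true, Bool.and_eq_true, List.any_eq_true] at h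
    obtain ⟨⟨⟨o', ho', e⟩, hrow⟩, h⟩ := h
    obtain rfl := Nat.eq_of_beq_eq_true e
    obtain ⟨j, c₁, hr, hcl, h⟩ := exists_run_of_tryHop h
    obtain ⟨b', c', L, zs', h1, h2, h3, h4⟩ := ih hr.2.2.2 h
    refine ⟨b', c', _, zs', .cons (onB_of_inRows hrow hcol) ho' hr hcl h1, ?_,
      fun z hz => h3 z (List.mem_cons_of_mem _ hz), h4⟩
    intro z hz
    rcases List.mem_cons.1 hz with rfl | hz
    exacts [h3 _ List.mem_cons_self, h2 z hz]

/-- A list of alternative continuations for the player to move.  `win os e` jumps along `os`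
to the goal, `play m s e` places a chap at `m` and continues with `s`, and `threat m os s e`
places a chap at `m` which threatens to jump along `os` to the goal, and continues with `s`
if the opponent meets the threat; `e` holds the remaining alternatives. -/
inductive Plan
  | fail
  | win (os : List ℕ) (e : Plan)
  | play (m : ℕ) (s e : Plan)
  | threat (m : ℕ) (os : List ℕ) (s e : Plan)

namespace Plan

/-- A bound for the number of moves until the win. -/
def depth : Plan → ℕ
  | fail => 0
  | win _ e => max 1 e.depth
  | play _ s e => max (s.depth + 2) e.depth
  | threat _ _ s e => max (max 1 s.depth + 2) e.depth

/-- The outcome for `p` if the ball is left at `b`, given `k` as the value of continued play. -/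
def verdict (p : Player) (b : ℕ) (k : Bool) : Bool :=
  bif goal p b then true else bif goal (!p) b then false else k

/-- Is some point of the board vacant? -/
def anyVacant (b c : ℕ) : Bool := cells.any (vacant b c)

/-- Does one of the alternatives win for player `p`, to move? -/
def check (p : Player) : Plan → ℕ → ℕ → Bool
  | fail, _, _ => false
  | win os e, b, c => follow (fun b' _ => goal p b') os b c [] || e.check p b c
  | play m s e, b, c =>
    (vacant b c m && anyVacant b (Nat.lor c (Nat.pow 2 m)) &&
      replies (fun b' c' => verdict p b' (s.check p b' c')) cells b (Nat.lor c (Nat.pow 2 m))) ||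
    e.check p b c
  | threat m os s e, b, c =>
    (vacant b c m && anyVacant b (Nat.lor c (Nat.pow 2 m)) &&
      follow (fun b' zs => goal p b' &&
        replies (fun b' c' => verdict p b' (s.check p b' c')) zs b (Nat.lor c (Nat.pow 2 m)))
        os b (Nat.lor c (Nat.pow 2 m)) []) ||
    e.check p b c

theorem exists_move_of_anyVacant {b c : ℕ} {q : Player} (hc : Inside c)
    (h : anyVacant b c = true) : ∃ t, MoveRel 12 10 (toState b c q) t := by
  obtain ⟨z, _, hz⟩ := List.any_eq_true.1 h
  exact ⟨_, moveRel_place hc hz⟩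

theorem wins_of_verdict {p : Player} {b c n : ℕ} {k : Bool} {q : Player}
    (hcol : 1 ≤ b % 16 ∧ b % 16 ≤ 10) (h : verdict p b k = true)
    (hk : OnB b → goal p b = false → goal (!p) b = false → k = true →
      Wins 12 10 p n (toState b c q)) : Wins 12 10 p n (toState b c q) := by
  cases h₁ : goal p b
  · cases h₂ : goal (!p) b
    · refine hk (onB_of_goal h₁ h₂ hcol) h₁ h₂ ?_
      simpa [verdict, h₁, h₂] using h
    · simp [verdict, h₁, h₂] at h
  · have : Wins 12 10 p 0 (toState b c q) := winner_of_goal c q h₁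
    exact this.mono n.zero_le

theorem Route.wins {p : Player} {b c b' c' : ℕ} {L : List ℕ} (h : Route b c L b' c')
    (hc : Inside c) (h₁ : goal p b = false) (h₂ : goal (!p) b = false)
    (hg : goal p b' = true) : Wins 12 10 p 1 (toState b c p) := by
  rcases h.jump hc with rfl | ⟨_, hJ⟩
  · rw [hg] at h₁; cases h₁
  · exact Wins.of_move (t := toState b' c' (!p)) (winner_eq_none c p h₁ h₂) rfl ⟨rfl, .inr hJ⟩
      (winner_of_goal c' (!p) hg)

theorem wins_of_check {p : Player} (T : Plan) {b c : ℕ} (hb : OnB b) (hc : Inside c)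
    (h₁ : goal p b = false) (h₂ : goal (!p) b = false) (h : T.check p b c = true) :
    Wins 12 10 p T.depth (toState b c p) := by
  have hw := winner_eq_none c p h₁ h₂
  have hcol : 1 ≤ b % 16 ∧ b % 16 ≤ 10 := ⟨hb.1, hb.2.1⟩
  induction T generalizing b c with
  | fail => simp [check] at h
  | win os e ihe =>
    rw [check, Bool.or_eq_true] at h
    rcases h with h | h
    · obtain ⟨b', c', L, _, hR, _, _, hg⟩ := exists_of_follow hcol h
      exact (Route.wins hR hc h₁ h₂ hg).mono (le_max_left _ _)
    · exact (ihe hb hc h₁ h₂ h hw hcol).mono (le_max_right _ _)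
  | play m s e ihs ihe =>
    rw [check, Bool.or_eq_true] at h
    rcases h with h | h
    · rw [Bool.and_eq_true, Bool.and_eq_true] at h
      obtain ⟨⟨hv, hany⟩, hrep⟩ := h
      have hc' := hc.lor (vacant_iff.1 hv).2.2
      refine Wins.mono (le_max_left _ _) (Wins.of_move hw rfl (moveRel_place hc hv) ?_)
      refine .inr ⟨winner_eq_none _ _ h₁ h₂, exists_move_of_anyVacant hc' hany,
        .inr ⟨by simp [toState], fun t ht => ?_⟩⟩
      rcases exists_of_replies hb hc' hrep ht with ⟨b', d, rfl, hd, hcol', hg⟩ | ⟨z, hz, hn, _⟩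
      · rw [Bool.not_not]
        exact wins_of_verdict hcol' hg fun hb' h₁' h₂' hk =>
          ihs hb' hd h₁' h₂' hk (winner_eq_none _ _ h₁' h₂') hcol'
      · exact absurd (mem_cells (vacant_iff.1 hz).2.2) hn
    · exact (ihe hb hc h₁ h₂ h hw hcol).mono (le_max_right _ _)
  | threat m os s e ihs ihe =>
    rw [check, Bool.or_eq_true] at h
    rcases h with h | h
    · rw [Bool.and_eq_true, Bool.and_eq_true] at h
      obtain ⟨⟨hv, hany⟩, hfol⟩ := h
      obtain ⟨b₁, c₁, L, zs, hR, hL, _, hg⟩ := exists_of_follow hcol hfol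
      rw [Bool.and_eq_true] at hg
      obtain ⟨hg, hrep⟩ := hg
      have hc' := hc.lor (vacant_iff.1 hv).2.2
      refine Wins.mono (le_max_left _ _) (Wins.of_move hw rfl (moveRel_place hc hv) ?_)
      refine .inr ⟨winner_eq_none _ _ h₁ h₂, exists_move_of_anyVacant hc' hany,
        .inr ⟨by simp [toState], fun t ht => ?_⟩⟩
      rcases exists_of_replies hb hc' hrep ht with ⟨b', d, rfl, hd, hcol', hg'⟩ | ⟨z, hz, hn, rfl⟩
      · rw [Bool.not_not]
        refine Wins.mono (le_max_right _ _) ?_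
        exact wins_of_verdict hcol' hg' fun hb' h₁' h₂' hk =>
          ihs hb' hd h₁' h₂' hk (winner_eq_none _ _ h₁' h₂') hcol'
      · rw [Bool.not_not]
        obtain ⟨hz1, _, hz2⟩ := vacant_iff.1 hz
        obtain ⟨c'', hR'⟩ := hR.place hz1 fun hmem => hn (hL z hmem)
        exact (Route.wins hR' (hc'.lor hz2) h₁ h₂ hg).mono (le_max_left _ _)
    · exact (ihe hb hc h₁ h₂ h hw hcol).mono (le_max_right _ _)

/-- Do all moves from `b`, `c`, except the one that leads to `b₁`, `c₁`, lose against `p` by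
one of the alternatives in `T`? -/
def refutesExcept (p : Player) (T : Plan) (b c b₁ c₁ : ℕ) : Bool :=
  replies (fun b' c' => (Nat.beq b' b₁ && Nat.beq c' c₁) || verdict p b' (T.check p b' c'))
    cells b c

theorem eq_or_wins_of_refutesExcept {p : Player} {T : Plan} {b c b₁ c₁ : ℕ} (hb : OnB b)
    (hc : Inside c) (h : T.refutesExcept p b c b₁ c₁ = true) {t : PState}
    (ht : MoveRel 12 10 (toState b c (!p)) t) :
    t = toState b₁ c₁ p ∨ ∃ n, Wins 12 10 p n t := by
  rcases exists_of_replies hb hc h ht with ⟨b', d, rfl, hd, hcol', hg⟩ | ⟨z, hz, hn, _⟩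
  · rw [Bool.or_eq_true, Bool.and_eq_true, Nat.beq_eq, Nat.beq_eq] at hg
    rw [Bool.not_not]
    rcases hg with ⟨rfl, rfl⟩ | hg
    · exact .inl rfl
    · exact .inr ⟨T.depth, wins_of_verdict hcol' hg fun hb' h₁' h₂' hk =>
        wins_of_check T hb' hd h₁' h₂' hk⟩
  · exact absurd (mem_cells (vacant_iff.1 hz).2.2) hn

end Plan

/-! ### The cycle of positions -/

/-- The bitboard of `P0chaps`. -/
def baseChaps : ℕ :=
  [19, 22, 24, 35, 38, 40, 56, 69, 72, 83, 100, 104, 115, 119,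
    136, 147, 150, 163, 179, 181, 184, 195, 197, 200].foldl (fun c i => Nat.lor c (Nat.pow 2 i)) 0

/-- Ball and chaps of the `k`-th position of a cycle of eighteen positions, the players moving in
turn: the ball is at a2 while chaps are placed at b3, …, i10, then jumps over them to j11, where it
stays while chaps are placed at i10, …, b3, and then jumps back to a2. -/
def cyclePos (k : ℕ) : ℕ × ℕ :=
  if k < 9 then
    (33, (List.range k).foldl (fun c i => Nat.lor c (Nat.pow 2 (50 + 17 * i))) baseChaps)
  else
    (186, (List.range (k - 9)).foldl (fun c i => Nat.lor c (Nat.pow 2 (169 - 17 * i))) baseChaps)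

/-- The `k`-th position of the cycle, with Alfred to move when `k` is even. -/
def cycleState (k : ℕ) : PState :=
  toState (cyclePos k).1 (cyclePos k).2 (Nat.beq (k % 2) 0)

theorem onB_cyclePos (k : ℕ) : OnB (cyclePos k).1 := by
  unfold cyclePos
  split <;> norm_num [OnB]

theorem inside_cyclePos {k : ℕ} (hk : k < 18) : Inside (cyclePos k).2 := by
  have H : ∀ k < 18, (cyclePos k).2 < 2 ^ 208 ∧ ∀ i < 208, (cyclePos k).2.testBit i = true →
      1 ≤ i % 16 ∧ i % 16 ≤ 10 ∧ 1 ≤ i / 16 ∧ i / 16 ≤ 12 := by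
    decide +kernel
  intro i hi
  refine (H k hk).2 i ?_ hi
  by_contra h
  have := Nat.testBit_lt_two_pow ((H k hk).1.trans_le (Nat.pow_le_pow_right two_pos (not_lt.1 h)))
  rw [this] at hi
  cases hi

open Plan in
/-- Alternatives that between them refute every move by Alfred that leaves the cycle at the
position with the given number. -/
def cyclePlan : ℕ → Plan
  | 0 =>
    win [1] <|
    win [2] <|
    threat 17 [1] (
      threat 50 [2] (
        win [2] <|
        fail) <|
      fail) <|
    win [18, 0] <|
    fail
  | 2 =>
    win [2, 1] <|
    threat 99 [16, 2, 2, 1] (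
      win [2, 2, 1] <|
      win [2, 1] <|
      threat 66 [1, 2] (
        win [2] <|
        win [1, 2] <|
        fail) <|
      win [1] <|
      win [18, 2, 1] <|
      win [16, 2, 2, 0] <|
      win [16, 2, 1] <|
      win [0, 18, 2, 1] <|
      fail) <|
    threat 99 [2, 2, 1] (
      win [2, 1] <|
      threat 66 [1, 2] (
        win [2] <|
        win [1, 2] <|
        fail) <|
      win [1] <|
      win [2, 2, 0] <|
      fail) <|
    threat 66 [1, 2] (
      win [2] <|
      win [1, 2] <|
      fail) <|
    win [1] <|
    win [2] <|
    win [34, 2, 1] <|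
    win [34, 2, 0] <|
    fail
  | 4 =>
    win [18, 1, 1] <|
    win [1, 1] <|
    threat 136 [1, 1, 1] (
      win [1, 1] <|
      win [1] <|
      fail) <|
    win [1] <|
    win [2] <|
    win [34, 18, 1, 1] <|
    win [34, 18, 1] <|
    win [34, 18, 0, 2, 0] <|
    fail
  | 6 =>
    win [1, 1, 1] <|
    win [1, 1] <|
    threat 119 [18, 1, 1] (
      win [1, 1] <|
      win [1] <|
      win [18, 1] <|
      win [18, 0, 2, 0] <|
      fail) <|
    win [1] <|
    win [2] <|
    win [34, 1, 1, 1] <|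
    win [34, 1, 1] <|
    fail
  | 8 =>
    play 186 (
      threat 17 [1] fail <|
      win [1] <|
      win [2] <|
      win [18, 0] <|
      win [33, 2] <|
      win [18, 2] <|
      fail) <|
    win [1] <|
    win [2] <|
    win [18, 0] <|
    win [33, 2] <|
    threat 17 [1] fail <|
    threat 18 [2] (
      threat 169 [0, 1, 1, 1] (
        win [1, 1, 1] <|
        win [1, 1] <|
        threat 119 [18, 1, 1] (
          win [1, 1] <|
          win [1] <|
          win [18, 1] <|
          win [18, 0, 2, 0] <|
          fail) <|
        win [1] <|
        win [0, 1, 1] <|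
        threat 135 [0, 18, 1, 1] (
          win [18, 1, 1] <|
          win [1, 1] <|
          threat 136 [1, 1, 1] (
            win [1, 1] <|
            win [1] <|
            fail) <|
          win [1] <|
          win [0, 18, 1] <|
          win [0, 18, 0, 2, 0] <|
          threat 101 [0, 2, 1] (
            win [2, 1] <|
            threat 99 [16, 2, 2, 1] (
              win [2, 2, 1] <|
              win [2, 1] <|
              threat 66 [1, 2] (
                win [2] <|
                win [1, 2] <|
                fail) <|
              win [1] <|
              win [18, 2, 1] <|
              win [16, 2, 2, 0] <|
              win [16, 2, 1] <|
              win [0, 18, 2, 1] <|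
              fail) <|
            threat 99 [2, 2, 1] (
              win [2, 1] <|
              threat 66 [1, 2] (
                win [2] <|
                win [1, 2] <|
                fail) <|
              win [1] <|
              win [2, 2, 0] <|
              fail) <|
            threat 66 [1, 2] (
              win [2] <|
              win [1, 2] <|
              fail) <|
            win [1] <|
            win [0, 2, 0] <|
            threat 67 [0, 2] (
              win [2] <|
              win [0, 2] <|
              fail) <|
            fail) <|
          fail) <|
        fail) <|
      fail) <|
    fail
  | 10 =>
    win [1, 1, 1] <|
    win [1, 1] <|
    threat 119 [18, 1, 1] (
      win [1, 1] <|
      win [1] <|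
      win [18, 0, 2, 0] <|
      win [18, 1] <|
      fail) <|
    win [1] <|
    win [0, 1, 1, 1] <|
    win [0, 1, 1] <|
    fail
  | 12 =>
    win [18, 1, 1] <|
    win [1, 1] <|
    win [1] <|
    threat 136 [1, 1, 1] (
      win [1, 1] <|
      win [1] <|
      fail) <|
    win [0, 18, 1, 1] <|
    win [0, 18, 0, 2, 0] <|
    win [0, 18, 1] <|
    fail
  | 14 =>
    win [2, 1] <|
    threat 66 [1, 2] (
      win [2] <|
      win [1, 2] <|
      fail) <|
    win [1] <|
    threat 99 [16, 2, 2, 1] (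
      win [2, 2, 1] <|
      win [2, 1] <|
      threat 66 [1, 2] (
        win [2] <|
        win [1, 2] <|
        fail) <|
      win [1] <|
      win [18, 2, 1] <|
      win [0, 18, 2, 1] <|
      win [16, 2, 1] <|
      win [16, 2, 2, 0] <|
      fail) <|
    threat 99 [2, 2, 1] (
      win [2, 1] <|
      threat 66 [1, 2] (
        win [2] <|
        win [1, 2] <|
        fail) <|
      win [1] <|
      win [2, 2, 0] <|
      fail) <|
    win [0, 2, 1] <|
    win [0, 2, 0] <|
    fail
  | 16 =>
    win [2] <|
    win [0, 2] <|
    fail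
  | _ => fail

theorem refutesExcept_cyclePlan : ∀ k < 18, k % 2 = 0 →
    (cyclePlan k).refutesExcept false (cyclePos k).1 (cyclePos k).2
      (cyclePos ((k + 1) % 18)).1 (cyclePos ((k + 1) % 18)).2 = true := by
  decide +kernel

theorem P7_eq : P7 = cycleState 7 := by
  have h : P7.chaps = (cycleState 7).chaps := by decide +kernel
  exact congrArg (fun s => (⟨(1, 2), s, false⟩ : PState)) h

theorem P7_i10_eq : P7_i10 = cycleState 8 := by
  have h : P7_i10.chaps = (cycleState 8).chaps := by decide +kernel
  exact congrArg (fun s => (⟨(1, 2), s, true⟩ : PState)) h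

theorem goal_cyclePos (p : Player) (k : ℕ) : goal p (cyclePos k).1 = false := by
  unfold cyclePos
  split <;> cases p <;> rfl

theorem winner_cycleState (k : ℕ) : winner 12 (cycleState k) = none :=
  winner_eq_none (p := true) _ _ (goal_cyclePos _ k) (goal_cyclePos _ k)

theorem moveRel_cycleState_of_vacant {k z : ℕ} (hk : k + 1 < 18)
    (hz : vacant (cyclePos k).1 (cyclePos k).2 z = true)
    (hb : cyclePos (k + 1) = ((cyclePos k).1, Nat.lor (cyclePos k).2 (Nat.pow 2 z))) :
    MoveRel 12 10 (cycleState k) (cycleState (k + 1)) := by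
  have h := moveRel_place (q := Nat.beq (k % 2) 0) (inside_cyclePos (by omega : k < 18)) hz
  have e : Nat.beq ((k + 1) % 2) 0 = !Nat.beq (k % 2) 0 := by
    rcases Nat.mod_two_eq_zero_or_one k with h | h
    · rw [h, show (k + 1) % 2 = 1 by omega]; rfl
    · rw [h, show (k + 1) % 2 = 0 by omega]; rfl
  rw [cycleState, cycleState, hb, e]
  exact h

theorem moveRel_cycleState_jump : MoveRel 12 10 (cycleState 17) (cycleState 0) := by
  have h : tryHop 0 (cyclePos 17).1 (cyclePos 17).2 false (fun b c =>
      Nat.beq b (cyclePos 0).1 && Nat.beq c (cyclePos 0).2) = true := by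
    decide +kernel
  obtain ⟨j, c, hr, hcl, h⟩ := exists_run_of_tryHop h
  rw [Bool.and_eq_true, Nat.beq_eq, Nat.beq_eq] at h
  have hop := hr.hop hcl (by decide) (onB_cyclePos 17) (inside_cyclePos (by decide))
  rw [h.1, h.2] at hop
  exact ⟨rfl, .inr (.single hop)⟩

theorem moveRel_cycleState {k : ℕ} (hk : k < 18) (hodd : k % 2 = 1) :
    MoveRel 12 10 (cycleState k) (cycleState ((k + 1) % 18)) := by
  by_cases h : k = 17
  · subst h; exact moveRel_cycleState_jump
  · have H : ∀ k < 17, k % 2 = 1 → ∃ z < 208, vacant (cyclePos k).1 (cyclePos k).2 z = true ∧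
        cyclePos (k + 1) = ((cyclePos k).1, Nat.lor (cyclePos k).2 (Nat.pow 2 z)) := by
      decide +kernel
    obtain ⟨z, _, hz, hb⟩ := H k (by omega) hodd
    rw [Nat.mod_eq_of_lt (by omega)]
    exact moveRel_cycleState_of_vacant (by omega) hz hb

theorem cycleState_turn (k : ℕ) : (cycleState k).turn = Nat.beq (k % 2) 0 := rfl

/-- The positions of the cycle and those from which Betty can force a win. -/
def bettySafe : Set PState :=
  {s | (∃ k < 18, s = cycleState k) ∨ ∃ n, Wins 12 10 false n s}

theorem mem_bettySafe_of_alfred_moves {s t : PState} (hs : s ∈ bettySafe)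
    (hw : winner 12 s = none) (ht : s.turn = true) (hm : MoveRel 12 10 s t) :
    t ∈ bettySafe := by
  rcases hs with ⟨k, hk, rfl⟩ | ⟨n, hn⟩
  · have hk2 : k % 2 = 0 := by rwa [cycleState_turn, Nat.beq_eq] at ht
    have hm' : MoveRel 12 10 (toState (cyclePos k).1 (cyclePos k).2 (!false)) t := by
      rwa [cycleState, hk2] at hm
    rcases Plan.eq_or_wins_of_refutesExcept (onB_cyclePos k) (inside_cyclePos hk)
      (refutesExcept_cyclePlan k hk hk2) hm' with rfl | h
    · refine .inl ⟨(k + 1) % 18, Nat.mod_lt _ (by decide), ?_⟩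
      rw [cycleState, show (k + 1) % 18 % 2 = 1 by omega]
      rfl
    · exact .inr h
  · cases n with
    | zero => rw [Wins, hw] at hn; cases hn
    | succ n =>
      rcases hn with hn | ⟨_, _, ⟨hf, _⟩ | ⟨_, hall⟩⟩
      · rw [hw] at hn; cases hn
      · rw [ht] at hf; cases hf
      · exact .inr ⟨n, hall t hm⟩

theorem exists_betty_move {s : PState} (hs : s ∈ bettySafe) (hw : winner 12 s = none)
    (ht : s.turn ≠ true) : ∃ t ∈ bettySafe, MoveRel 12 10 s t := by
  rcases hs with ⟨k, hk, rfl⟩ | ⟨n, hn⟩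
  · rw [cycleState_turn, Ne, Nat.beq_eq] at ht
    exact ⟨_, .inl ⟨_, Nat.mod_lt _ (by decide), rfl⟩, moveRel_cycleState hk (by omega)⟩
  · cases n with
    | zero => rw [Wins, hw] at hn; cases hn
    | succ n =>
      rcases hn with hn | ⟨_, _, ⟨_, t, hm, h⟩ | ⟨hf, _⟩⟩
      · rw [hw] at hn; cases hn
      · exact ⟨t, .inr ⟨n, h⟩, hm⟩
      · exact absurd (by simpa using ht) hf

theorem winner_ne_of_mem_bettySafe {s : PState} (hs : s ∈ bettySafe) :
    winner 12 s ≠ some true := by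
  rcases hs with ⟨k, _, rfl⟩ | ⟨n, hn⟩
  · rw [winner_cycleState]; simp
  · cases n with
    | zero => rw [Wins] at hn; simp [hn]
    | succ n =>
      rcases hn with hn | ⟨hn, _⟩ <;> simp [hn]

open Plan in
theorem refutesExcept_P7 :
    (win [32] <| win [34, 32] fail).refutesExcept true (cyclePos 7).1 (cyclePos 7).2
      (cyclePos 8).1 (cyclePos 8).2 = true := by
  decide +kernel

/-- From `P7`, placing a chap at i10 is Betty's unique non-losing move:
it is a legal move; after it, Alfred has no winning strategy from the resulting
position; and every other legal move of Betty from `P7` leads to a position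
from which Alfred has a winning strategy. -/
theorem P7_unique_nonlosing :
    MoveRel 12 10 P7 P7_i10 ∧
    ¬ WinsFrom 12 10 true P7_i10 ∧
    ∀ t, MoveRel 12 10 P7 t → t ≠ P7_i10 → WinsFrom 12 10 true t := by
  refine ⟨?_, ?_, fun t hm hne => ?_⟩
  · rw [P7_eq, P7_i10_eq]
    exact moveRel_cycleState (by decide) rfl
  · rw [P7_i10_eq]
    exact not_winsFrom_of_safe bettySafe (fun s hs => winner_ne_of_mem_bettySafe hs)
      (fun s hs hw ht t hm => mem_bettySafe_of_alfred_moves hs hw ht hm)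
      (fun s hs hw ht _ => exists_betty_move hs hw ht) (.inl ⟨8, by decide, rfl⟩)
  · rw [P7_eq] at hm
    rcases Plan.eq_or_wins_of_refutesExcept (onB_cyclePos 7) (inside_cyclePos (by decide))
      refutesExcept_P7 hm with rfl | ⟨n, hn⟩
    · exact absurd P7_i10_eq.symm hne
    · exact hn.winsFrom
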